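/- Estimate (2.13): there exists a constant c > 0 such that for every even function u : ℝ → ℝ that is twice differentiable with u, u', u'' square-integrable and satisfies ⟨u, η⟩ = 0, one has both ‖Au‖_{L²} ≥ c·‖u‖_{H¹} and ‖Au‖_{L²}² ≥ c·⟨u, Au⟩, where Au := P_W( (1/8)·u − (1/2)·u'' − 3·η²·u ) and P_W w = w − ⟨w,η⟩η. -/

import Mathlib

open MeasureTheory

/-- The ground state `η(x) = (1/2) sech(x/2)`. -/
noncomputable def eta (x : ℝ) : ℝ := (1/2) * (1 / Real.cosh (x/2))

/-- Squared `H¹` norm: `‖f‖_{H¹}² = ∫ (f² + f'²)`. -/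
noncomputable def H1sq (f : ℝ → ℝ) : ℝ := ∫ x : ℝ, ((f x)^2 + (deriv f x)^2)

/-- The linearized operator `Au = P_W((1/8)u − (1/2)u'' − 3η²u)`, where
`P_W w = w − ⟨w,η⟩η` is the `L²`-projection onto the orthogonal complement of `η`. -/
noncomputable def Aop (u : ℝ → ℝ) : ℝ → ℝ := fun x =>
  ((1/8) * u x - (1/2) * deriv (deriv u) x - 3 * (eta x)^2 * u x) -
    (∫ y : ℝ, ((1/8) * u y - (1/2) * deriv (deriv u) y - 3 * (eta y)^2 * u y) * eta y) * eta x

/-! ### The ground state and its scaling derivative -/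

lemma eta_pos (x : ℝ) : 0 < eta x := by
  have := Real.cosh_pos (x / 2)
  unfold eta; positivity

lemma eta_neg (x : ℝ) : eta (-x) = eta x := by
  simp [eta, neg_div]

lemma tanh_sq_add_four_eta_sq (x : ℝ) : Real.tanh (x / 2) ^ 2 + 4 * eta x ^ 2 = 1 := by
  have h := Real.cosh_pos (x / 2)
  have h2 := Real.cosh_sq (x / 2)
  rw [Real.tanh_eq_sinh_div_cosh, eta]
  field_simp
  linarith

lemma eta_le_half (x : ℝ) : eta x ≤ 1 / 2 := by
  nlinarith [tanh_sq_add_four_eta_sq x, sq_nonneg (Real.tanh (x / 2)), eta_pos x]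

lemma hasDerivAt_tanh_half (x : ℝ) :
    HasDerivAt (fun y => Real.tanh (y / 2)) ((1 - Real.tanh (x / 2) ^ 2) / 2) x := by
  have h := Real.cosh_pos (x / 2)
  have hx : HasDerivAt (fun y : ℝ => y / 2) (1 / 2) x := (hasDerivAt_id x).div_const 2
  have := hx.sinh.div hx.cosh h.ne'
  have he : (fun y => Real.tanh (y / 2)) =
      (fun y => Real.sinh (y / 2)) / fun y => Real.cosh (y / 2) := by
    ext y; simp [Real.tanh_eq_sinh_div_cosh]
  rw [he]
  refine this.congr_deriv ?_
  rw [Real.tanh_eq_sinh_div_cosh]; field_simp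

lemma hasDerivAt_eta (x : ℝ) :
    HasDerivAt eta (-(1 / 2) * eta x * Real.tanh (x / 2)) x := by
  have h := Real.cosh_pos (x / 2)
  have hx : HasDerivAt (fun y : ℝ => y / 2) (1 / 2) x := (hasDerivAt_id x).div_const 2
  have := (hx.cosh.inv h.ne').const_mul (1 / 2)
  have he : eta = fun y => 1 / 2 * (fun x => Real.cosh (x / 2))⁻¹ y := by
    ext y; simp [eta]
  rw [he]
  refine this.congr_deriv ?_
  simp only [Pi.inv_apply]
  rw [Real.tanh_eq_sinh_div_cosh]; field_simp

lemma continuous_eta : Continuous eta :=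
  continuous_iff_continuousAt.2 fun x => (hasDerivAt_eta x).continuousAt

/-- The derivative of the scaling family `μ ↦ μ η(μ x)` at `μ = 1`, i.e. `η + x η'`. -/
noncomputable def etaScaling (x : ℝ) : ℝ := eta x - 1 / 2 * (x * eta x * Real.tanh (x / 2))

/-- The derivative of `etaScaling`. -/
noncomputable def etaScalingDeriv (x : ℝ) : ℝ :=
  -(eta x * Real.tanh (x / 2)) + 1 / 4 * (x * eta x * (2 * Real.tanh (x / 2) ^ 2 - 1))

lemma hasDerivAt_etaScaling (x : ℝ) : HasDerivAt etaScaling (etaScalingDeriv x) x := by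
  have := (hasDerivAt_eta x).sub
    ((((hasDerivAt_id x).mul (hasDerivAt_eta x)).mul (hasDerivAt_tanh_half x)).const_mul (1 / 2))
  refine this.congr_deriv ?_
  simp only [etaScalingDeriv, id, Pi.mul_apply]; ring

lemma hasDerivAt_etaScalingDeriv (x : ℝ) : HasDerivAt etaScalingDeriv
    ((1 / 4 - 6 * eta x ^ 2) * etaScaling x + 1 / 2 * eta x) x := by
  have hT := hasDerivAt_tanh_half x
  have := ((hasDerivAt_eta x).mul hT).neg.add
    ((((hasDerivAt_id x).mul (hasDerivAt_eta x)).mul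
      (((hT.pow 2).const_mul 2).sub_const 1)).const_mul (1 / 4))
  refine this.congr_deriv ?_
  simp only [etaScaling, id, Pi.mul_apply, Pi.pow_apply, Nat.cast_ofNat]
  have h6 : 6 * eta x ^ 2 = 3 / 2 * (1 - Real.tanh (x / 2) ^ 2) := by
    linarith [tanh_sq_add_four_eta_sq x]
  rw [h6]; ring

lemma etaScaling_neg (x : ℝ) : etaScaling (-x) = etaScaling x := by
  simp [etaScaling, eta_neg, neg_div]

lemma one_add_abs_mul_eta_le (x : ℝ) : (1 + |x|) * eta x ≤ 48 * (1 + x ^ 2)⁻¹ := by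
  have hr := abs_nonneg x
  have h := Real.sum_le_exp_of_nonneg (x := |x| / 2) (by positivity) 4
  simp [Finset.sum_range_succ, Nat.factorial] at h
  have hc : Real.exp (|x| / 2) ≤ 2 * Real.cosh (x / 2) := by
    rw [← Real.cosh_abs (x / 2), abs_div, abs_two, Real.cosh_eq]
    linarith [Real.exp_pos (-(|x| / 2))]
  have hpos := Real.cosh_pos (x / 2)
  rw [eta, ← sq_abs x]
  generalize |x| = r at *
  generalize Real.cosh (x / 2) = C at *
  rw [← div_eq_mul_inv, le_div_iff₀ (by positivity)]
  field_simp
  nlinarith [pow_nonneg hr 2, pow_nonneg hr 3]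

lemma integrable_and_memLp_of_abs_le_eta {g : ℝ → ℝ} {C : ℝ} (hg : Continuous g)
    (hb : ∀ x, |g x| ≤ C * ((1 + |x|) * eta x)) : Integrable g ∧ MemLp g 2 := by
  have hC : 0 ≤ C := by
    have h := (abs_nonneg _).trans (hb 0)
    have := eta_pos 0
    simp only [abs_zero, add_zero, one_mul] at h
    exact nonneg_of_mul_nonneg_left h this
  have hb' : ∀ x, ‖g x‖ ≤ C * (48 * (1 + x ^ 2)⁻¹) := fun x =>
    (hb x).trans (mul_le_mul_of_nonneg_left (one_add_abs_mul_eta_le x) hC)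
  have hint : Integrable g :=
    ((integrable_inv_one_add_sq.const_mul 48).const_mul C).mono' hg.aestronglyMeasurable
      (.of_forall hb')
  refine ⟨hint, (memLp_two_iff_integrable_sq hg.aestronglyMeasurable).2 ?_⟩
  refine (hint.norm.const_mul (C * 48)).mono' (by fun_prop) (.of_forall fun x => ?_)
  have h1 : ‖g x‖ ≤ C * 48 := by
    refine (hb' x).trans ?_
    have : (1 + x ^ 2)⁻¹ ≤ 1 := inv_le_one_of_one_le₀ (by nlinarith [sq_nonneg x])
    nlinarith
  rw [norm_pow, sq]
  exact mul_le_mul_of_nonneg_right h1 (norm_nonneg _)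

lemma continuous_etaScaling : Continuous etaScaling :=
  continuous_iff_continuousAt.2 fun x => (hasDerivAt_etaScaling x).continuousAt

lemma continuous_etaScalingDeriv : Continuous etaScalingDeriv :=
  continuous_iff_continuousAt.2 fun x => (hasDerivAt_etaScalingDeriv x).continuousAt

lemma memLp_eta : MemLp eta 2 :=
  (integrable_and_memLp_of_abs_le_eta (C := 1) continuous_eta fun x => by
    rw [abs_of_pos (eta_pos x)]
    nlinarith [eta_pos x, mul_nonneg (abs_nonneg x) (eta_pos x).le]).2

lemma memLp_id_mul_eta : MemLp (fun x => x * eta x) 2 :=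
  (integrable_and_memLp_of_abs_le_eta (C := 1)
    (g := fun x => x * eta x) (continuous_id.mul continuous_eta) fun x => by
    rw [abs_mul, abs_of_pos (eta_pos x)]
    nlinarith [eta_pos x, mul_nonneg (abs_nonneg x) (eta_pos x).le]).2

lemma memLp_etaScaling : MemLp etaScaling 2 :=
  (integrable_and_memLp_of_abs_le_eta (C := 1) continuous_etaScaling fun x => by
    have h1 := (Real.abs_tanh_lt_one (x / 2)).le
    have h2 := mul_nonneg (abs_nonneg x) (eta_pos x).le
    have h3 : |x * eta x * Real.tanh (x / 2)| ≤ |x| * eta x := by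
      rw [abs_mul, abs_mul, abs_of_pos (eta_pos x)]
      exact mul_le_of_le_one_right h2 h1
    have := abs_le.1 h3
    rw [etaScaling, abs_le]
    constructor <;> nlinarith [eta_pos x]).2

lemma memLp_etaScalingDeriv : MemLp etaScalingDeriv 2 :=
  (integrable_and_memLp_of_abs_le_eta (C := 1) continuous_etaScalingDeriv fun x => by
    have h1 := (Real.abs_tanh_lt_one (x / 2)).le
    have h2 := mul_nonneg (abs_nonneg x) (eta_pos x).le
    have h3 : |x * eta x * (2 * Real.tanh (x / 2) ^ 2 - 1)| ≤ |x| * eta x := by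
      rw [abs_mul, abs_mul, abs_of_pos (eta_pos x)]
      refine mul_le_of_le_one_right h2 (abs_le.2 ⟨?_, ?_⟩)
      · nlinarith [sq_nonneg (Real.tanh (x / 2))]
      · nlinarith [(sq_le_one_iff_abs_le_one _).2 h1]
    have h4 : |eta x * Real.tanh (x / 2)| ≤ eta x := by
      rw [abs_mul, abs_of_pos (eta_pos x)]
      exact mul_le_of_le_one_right (eta_pos x).le h1
    have := abs_le.1 h3
    have := abs_le.1 h4
    rw [etaScalingDeriv, abs_le]
    constructor <;> nlinarith [eta_pos x]).2

/-! ### A Riccati criterion for nonnegativity of quadratic forms -/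

lemma hasDerivAt_bounded_mul_sq_of_eq_zero {G w : ℝ → ℝ} {M w' x : ℝ} (hG : ∀ y, |G y| ≤ M)
    (hw : HasDerivAt w w' x) (h0 : w x = 0) : HasDerivAt (fun y => G y * w y ^ 2) 0 x := by
  have h2 : HasDerivAt (fun y => w y ^ 2) 0 x := by
    refine (hw.pow 2).congr_deriv ?_
    simp [h0]
  rw [hasDerivAt_iff_isLittleO] at h2 ⊢
  simp only [h0, smul_zero, sub_zero, ne_eq, OfNat.ofNat_ne_zero, not_false_eq_true, zero_pow,
    mul_zero] at h2 ⊢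
  refine Asymptotics.IsBigO.trans_isLittleO (Asymptotics.IsBigO.of_bound M ?_) h2
  refine .of_forall fun y => ?_
  rw [norm_mul]
  exact mul_le_mul_of_nonneg_right (hG y) (norm_nonneg _)

/-- If `G` is a bounded solution of `G' + G² ≤ W` away from the zeros of `w`, then the quadratic
form `∫ (w'² + W w²)` is nonnegative. -/
lemma integral_nonneg_of_riccati {w G G' W : ℝ → ℝ} {M : ℝ} (hw : Differentiable ℝ w)
    (hw2 : Integrable fun x => w x ^ 2) (hdw2 : Integrable fun x => deriv w x ^ 2)
    (hM : ∀ x, |G x| ≤ M) (hM' : ∀ x, |G' x| ≤ M)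
    (hG : ∀ x, w x = 0 ∨ HasDerivAt G (G' x) x)
    (hW : ∀ x, w x = 0 ∨ G' x + G x ^ 2 ≤ W x)
    (hint : Integrable fun x => deriv w x ^ 2 + W x * w x ^ 2) :
    0 ≤ ∫ x, (deriv w x ^ 2 + W x * w x ^ 2) := by
  have hF : ∀ x, HasDerivAt (fun y => G y * w y ^ 2)
      (G' x * w x ^ 2 + G x * (2 * w x * deriv w x)) x := fun x => by
    rcases eq_or_ne (w x) 0 with h0 | h0
    · simpa [h0] using hasDerivAt_bounded_mul_sq_of_eq_zero hM (hw x).hasDerivAt h0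
    · refine (((hG x).resolve_left h0).mul ((hw x).hasDerivAt.pow 2)).congr_deriv ?_
      simp
  have hcont : Continuous fun y => G y * w y ^ 2 :=
    continuous_iff_continuousAt.2 fun x => (hF x).continuousAt
  have hFint : Integrable fun y => G y * w y ^ 2 := by
    refine (hw2.const_mul M).mono' hcont.aestronglyMeasurable (.of_forall fun x => ?_)
    rw [norm_mul, Real.norm_of_nonneg (sq_nonneg (w x))]
    exact mul_le_mul_of_nonneg_right (hM x) (sq_nonneg _)
  have hFint' : Integrable fun x => G' x * w x ^ 2 + G x * (2 * w x * deriv w x) := by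
    refine ((hw2.const_mul (2 * M)).add (hdw2.const_mul M)).mono' ?_ (.of_forall fun x => ?_)
    · rw [← show deriv (fun y => G y * w y ^ 2) = _ from funext fun x => (hF x).deriv]
      exact (measurable_deriv _).aestronglyMeasurable
    · have h1 : ‖G' x * w x ^ 2‖ ≤ M * w x ^ 2 := by
        rw [norm_mul, Real.norm_of_nonneg (sq_nonneg (w x))]
        exact mul_le_mul_of_nonneg_right (hM' x) (sq_nonneg _)
      have h2 : ‖2 * w x * deriv w x‖ ≤ w x ^ 2 + deriv w x ^ 2 := by
        rw [Real.norm_eq_abs, abs_le]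
        constructor <;> nlinarith [sq_nonneg (w x + deriv w x), sq_nonneg (w x - deriv w x)]
      have h3 : ‖G x * (2 * w x * deriv w x)‖ ≤ M * (w x ^ 2 + deriv w x ^ 2) := by
        rw [norm_mul]
        exact mul_le_mul (hM x) h2 (norm_nonneg _) ((abs_nonneg _).trans (hM x))
      refine (norm_add_le _ _).trans ?_
      simp only [Pi.add_apply]
      linarith
  rw [← integral_eq_zero_of_hasDerivAt_of_integrable hF hFint' hFint]
  refine integral_mono hFint' hint fun x => ?_
  rcases hW x with h | h
  · simp only [h]; nlinarith [sq_nonneg (deriv w x)]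
  · simp only
    nlinarith [sq_nonneg (deriv w x - G x * w x), mul_le_mul_of_nonneg_right h (sq_nonneg (w x))]

/-! ### The Schrödinger form on functions vanishing at `±34/25` -/

/-- A Riccati subsolution for the potential `1/4 - 6η²`, singular at `±34/25`. -/
noncomputable def riccati (x : ℝ) : ℝ :=
  if |x| < 34 / 25 then -(113 / 100 * Real.tan (113 / 100 * x))
  else 51 / 100 / Real.tanh (x / 2) - Real.tanh (x / 2)

/-- The derivative of `riccati` away from its singularities. -/
noncomputable def riccatiDeriv (x : ℝ) : ℝ :=
  if |x| < 34 / 25 then -((113 / 100) ^ 2 * (1 + Real.tan (113 / 100 * x) ^ 2))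
  else -((51 / 100 / Real.tanh (x / 2) ^ 2 + 1) * ((1 - Real.tanh (x / 2) ^ 2) / 2))

lemma cos_pos_of_abs_lt {x : ℝ} (hx : |x| < 34 / 25) : 0 < Real.cos (113 / 100 * x) := by
  have := Real.pi_gt_d2
  have := abs_lt.1 hx
  apply Real.cos_pos_of_mem_Ioo
  constructor <;> linarith

lemma le_tanh_half_sq {x : ℝ} (hx : 34 / 25 ≤ |x|) : 69 / 200 ≤ Real.tanh (x / 2) ^ 2 := by
  have hE := Real.sum_le_exp_of_nonneg (x := 34 / 25) (by norm_num) 6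
  norm_num [Finset.sum_range_succ, Nat.factorial] at hE
  have hE' : 388 / 100 ≤ Real.exp (34 / 25) := le_trans (by norm_num) hE
  have hc : 2067 / 1000 ≤ Real.cosh (34 / 25) := by
    rw [Real.cosh_eq, Real.exp_neg, le_div_iff₀ two_pos, ← sub_nonneg]
    generalize Real.exp (34 / 25) = E at hE'
    have : E + E⁻¹ - 2067 / 1000 * 2 = (E ^ 2 + 1 - 2067 / 500 * E) / E := by
      field_simp
      ring
    rw [this]
    apply div_nonneg <;> nlinarith
  have hc2 : 2067 / 1000 ≤ Real.cosh x :=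
    hc.trans (Real.cosh_le_cosh.2 (by rwa [abs_of_pos (by norm_num : (0 : ℝ) < 34 / 25)]))
  have h1 := Real.cosh_sq (x / 2)
  have h2 := Real.cosh_two_mul (x / 2)
  rw [mul_div_cancel₀ x two_ne_zero] at h2
  have h3 := Real.cosh_pos (x / 2)
  rw [Real.tanh_eq_sinh_div_cosh, div_pow, le_div_iff₀ (by positivity)]
  linarith

lemma tanh_half_sq_le_one (x : ℝ) : Real.tanh (x / 2) ^ 2 ≤ 1 := by
  nlinarith [tanh_sq_add_four_eta_sq x, sq_nonneg (eta x)]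

lemma hasDerivAt_riccati {x : ℝ} (hx : |x| ≠ 34 / 25) :
    HasDerivAt riccati (riccatiDeriv x) x := by
  rcases hx.lt_or_gt with h | h
  · have hc := cos_pos_of_abs_lt h
    have hd := ((Real.hasDerivAt_tan hc.ne').comp x
      ((hasDerivAt_id x).const_mul (113 / 100))).const_mul (-(113 / 100 : ℝ))
    have he : riccati =ᶠ[nhds x] fun y => -(113 / 100) * Real.tan (113 / 100 * y) := by
      filter_upwards [(isOpen_lt continuous_abs continuous_const).mem_nhds h] with y hy
      rw [riccati, if_pos hy]; ring
    refine (HasDerivAt.congr_of_eventuallyEq hd he).congr_deriv ?_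
    have hsec : 1 / Real.cos (113 / 100 * x) ^ 2 = 1 + Real.tan (113 / 100 * x) ^ 2 := by
      rw [div_eq_iff (by positivity), Real.one_add_tan_sq_mul_cos_sq_eq_one hc.ne']
    rw [riccatiDeriv, if_pos h, hsec]
    ring
  · have ht : Real.tanh (x / 2) ≠ 0 := fun h0 => by
      have := le_tanh_half_sq h.le
      norm_num [h0] at this
    have hT := hasDerivAt_tanh_half x
    have hd := ((hT.inv ht).const_mul (51 / 100)).sub hT
    have he : riccati =ᶠ[nhds x]
        fun y => 51 / 100 * (Real.tanh (y / 2))⁻¹ - Real.tanh (y / 2) := by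
      filter_upwards [(isOpen_lt continuous_const continuous_abs).mem_nhds h] with y hy
      rw [riccati, if_neg (not_lt.2 (le_of_lt hy)), div_eq_mul_inv]
    refine (HasDerivAt.congr_of_eventuallyEq hd he).congr_deriv ?_
    rw [riccatiDeriv, if_neg (not_lt.2 h.le)]
    field_simp
    ring

lemma riccatiDeriv_add_sq_le (x : ℝ) :
    riccatiDeriv x + riccati x ^ 2 ≤ 1 / 4 - 6 * eta x ^ 2 - 1 / 10000 := by
  have hη := tanh_sq_add_four_eta_sq x
  have hT1 := tanh_half_sq_le_one x
  unfold riccati riccatiDeriv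
  split_ifs with h
  · nlinarith [sq_nonneg (Real.tanh (x / 2))]
  · have hT := le_tanh_half_sq (not_lt.1 h)
    have hη' : 6 * eta x ^ 2 = 3 / 2 * (1 - Real.tanh (x / 2) ^ 2) := by linarith
    rw [hη']
    generalize Real.tanh (x / 2) = T at *
    have hT0 : T ≠ 0 := by rintro rfl; norm_num at hT
    have hT2 : 0 < T ^ 2 := by positivity
    rw [← sub_nonneg]
    have : 1 / 4 - 3 / 2 * (1 - T ^ 2) - 1 / 10000 -
        (-((51 / 100 / T ^ 2 + 1) * ((1 - T ^ 2) / 2)) + (51 / 100 / T - T) ^ 2) =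
        ((149 / 10000) * T ^ 2 - 51 / 10000) / T ^ 2 := by
      field_simp
      ring
    rw [this]
    exact div_nonneg (by linarith) hT2.le

lemma exists_abs_riccati_le : ∃ M, ∀ x, |riccati x| ≤ M ∧ |riccatiDeriv x| ≤ M := by
  have hpi := Real.pi_gt_d2
  set t := Real.tan (113 / 100 * (34 / 25)) with ht
  refine ⟨max 2 (2 * (1 + t ^ 2)), fun x => ?_⟩
  unfold riccati riccatiDeriv
  split_ifs with h
  · have hx := abs_lt.1 h
    have h1 : Real.tan (113 / 100 * x) < t :=
      Real.tan_lt_tan_of_lt_of_lt_pi_div_two (by linarith) (by linarith) (by linarith)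
    have h2 : -t < Real.tan (113 / 100 * x) := by
      rw [ht, ← Real.tan_neg]
      exact Real.tan_lt_tan_of_lt_of_lt_pi_div_two (by linarith) (by linarith) (by linarith)
    have h3 : Real.tan (113 / 100 * x) ^ 2 ≤ t ^ 2 := by nlinarith
    constructor <;> refine le_trans ?_ (le_max_right _ _) <;> rw [abs_le] <;> constructor <;>
      nlinarith [sq_nonneg (t - 1), sq_nonneg (Real.tan (113 / 100 * x))]
  · have hT := le_tanh_half_sq (not_lt.1 h)
    have hT1 := tanh_half_sq_le_one x
    generalize Real.tanh (x / 2) = T at *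
    have hT0 : T ≠ 0 := by rintro rfl; norm_num at hT
    have hT2 : 0 < T ^ 2 := by positivity
    constructor <;> refine le_trans ?_ (le_max_left _ _)
    · refine abs_le_of_sq_le_sq ?_ two_pos.le
      have : (51 / 100 / T - T) ^ 2 = (51 / 100 - T ^ 2) ^ 2 / T ^ 2 := by field_simp
      rw [this, div_le_iff₀ hT2]
      nlinarith
    · rw [abs_neg, abs_of_nonneg (by
        apply mul_nonneg
        · positivity
        · linarith)]
      have h1 : 51 / 100 / T ^ 2 ≤ 2 := by rw [div_le_iff₀ hT2]; linarith
      nlinarith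

/-! ### Coercivity on even functions orthogonal to the ground state -/

lemma integrable_potential_mul {g : ℝ → ℝ} (hg : Integrable g) :
    Integrable fun x => (1 / 4 - 6 * eta x ^ 2) * g x := by
  have hc := continuous_eta
  refine (hg.norm.const_mul 2).mono'
    ((by fun_prop : Continuous fun x => 1 / 4 - 6 * eta x ^ 2).aestronglyMeasurable.mul
      hg.aestronglyMeasurable) (.of_forall fun x => ?_)
  rw [norm_mul]
  refine mul_le_mul_of_nonneg_right ?_ (norm_nonneg _)
  rw [Real.norm_eq_abs, abs_le]
  constructor <;> nlinarith [eta_pos x, eta_le_half x]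

lemma integral_eta_sq_pos : 0 < ∫ x, eta x ^ 2 := by
  have hint := (memLp_two_iff_integrable_sq continuous_eta.aestronglyMeasurable).1 memLp_eta
  rw [integral_pos_iff_support_of_nonneg (fun x => sq_nonneg _) hint]
  have : Function.support (fun x => eta x ^ 2) = Set.univ :=
    Set.eq_univ_of_forall fun x => (pow_pos (eta_pos x) 2).ne'
  simp [this]

lemma etaScaling_pos : 0 < etaScaling (34 / 25) := by
  have h := Real.tanh_lt_one (34 / 25 / 2)
  have he := eta_pos (34 / 25)
  rw [etaScaling]
  nlinarith [mul_pos he (sub_pos.2 h)]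

/-- Removing an `etaScaling` component from a function orthogonal to `η` lowers the form. -/
lemma integral_form_sub_etaScaling {u : ℝ → ℝ} (hu : Differentiable ℝ u)
    (hu2 : Integrable fun x => u x ^ 2) (hdu2 : Integrable fun x => deriv u x ^ 2)
    (horth : ∫ x, u x * eta x = 0) (a : ℝ) :
    ∫ x, ((deriv u x - a * etaScalingDeriv x) ^ 2 +
        (1 / 4 - 6 * eta x ^ 2) * (u x - a * etaScaling x) ^ 2) =
      (∫ x, (deriv u x ^ 2 + (1 / 4 - 6 * eta x ^ 2) * u x ^ 2)) -
        a ^ 2 / 4 * ∫ x, eta x ^ 2 := by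
  have hum : MemLp u 2 :=
    (memLp_two_iff_integrable_sq hu.continuous.aestronglyMeasurable).2 hu2
  have hdum : MemLp (deriv u) 2 :=
    (memLp_two_iff_integrable_sq (measurable_deriv u).aestronglyMeasurable).2 hdu2
  have hη2 : Integrable fun x => eta x ^ 2 := memLp_eta.integrable_sq
  have huη : Integrable fun x => u x * eta x := hum.integrable_mul memLp_eta
  have hQu : Integrable fun x => deriv u x ^ 2 + (1 / 4 - 6 * eta x ^ 2) * u x ^ 2 :=
    hdu2.add (integrable_potential_mul hu2)
  have hQw : Integrable fun x => (deriv u x - a * etaScalingDeriv x) ^ 2 +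
      (1 / 4 - 6 * eta x ^ 2) * (u x - a * etaScaling x) ^ 2 :=
    (hdum.sub (memLp_etaScalingDeriv.const_mul a)).integrable_sq.add
      (integrable_potential_mul (hum.sub (memLp_etaScaling.const_mul a)).integrable_sq)
  have hB : ∀ x, HasDerivAt (fun y => -2 * a * (u y * etaScalingDeriv y) +
      a ^ 2 * (etaScaling y * etaScalingDeriv y - 1 / 4 * (y * eta y * eta y)))
      (((deriv u x - a * etaScalingDeriv x) ^ 2 +
          (1 / 4 - 6 * eta x ^ 2) * (u x - a * etaScaling x) ^ 2) -
        (deriv u x ^ 2 + (1 / 4 - 6 * eta x ^ 2) * u x ^ 2) -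
        a * (u x * eta x) + a ^ 2 / 4 * eta x ^ 2) x := fun x => by
    have hf' := hasDerivAt_etaScalingDeriv x
    refine ((((hu x).hasDerivAt.mul hf').const_mul (-2 * a)).add
      ((((hasDerivAt_etaScaling x).mul hf').sub
        ((((hasDerivAt_id x).mul (hasDerivAt_eta x)).mul
          (hasDerivAt_eta x)).const_mul (1 / 4))).const_mul (a ^ 2))).congr_deriv ?_
    simp only [id, Pi.mul_apply]
    have hf : x * eta x * Real.tanh (x / 2) = 2 * (eta x - etaScaling x) := by
      rw [etaScaling]; ring
    linear_combination (a ^ 2 * eta x / 4) * hf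
  have hBint : Integrable fun y => -2 * a * (u y * etaScalingDeriv y) +
      a ^ 2 * (etaScaling y * etaScalingDeriv y - 1 / 4 * (y * eta y * eta y)) :=
    ((hum.integrable_mul memLp_etaScalingDeriv).const_mul _).add
      (((memLp_etaScaling.integrable_mul memLp_etaScalingDeriv).sub
        ((memLp_id_mul_eta.integrable_mul memLp_eta).const_mul _)).const_mul _)
  have h := integral_eq_zero_of_hasDerivAt_of_integrable hB
    (((hQw.sub hQu).sub (huη.const_mul a)).add (hη2.const_mul (a ^ 2 / 4))) hBint
  rw [integral_add (by exact (hQw.sub hQu).sub (huη.const_mul a)) (hη2.const_mul (a ^ 2 / 4)),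
    integral_sub (by exact hQw.sub hQu) (huη.const_mul a), integral_sub hQw hQu,
    integral_const_mul, integral_const_mul, horth] at h
  linarith

lemma integral_form_lower_bound_of_eq_zero {w : ℝ → ℝ} (hw : Differentiable ℝ w)
    (hw2 : Integrable fun x => w x ^ 2) (hdw2 : Integrable fun x => deriv w x ^ 2)
    (h0 : ∀ x, |x| = 34 / 25 → w x = 0) :
    1 / 10000 * ∫ x, w x ^ 2 ≤ ∫ x, (deriv w x ^ 2 + (1 / 4 - 6 * eta x ^ 2) * w x ^ 2) := by
  obtain ⟨M, hM⟩ := exists_abs_riccati_le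
  have hQ : Integrable fun x => deriv w x ^ 2 + (1 / 4 - 6 * eta x ^ 2) * w x ^ 2 :=
    hdw2.add (integrable_potential_mul hw2)
  have heq : (fun x => deriv w x ^ 2 + (1 / 4 - 6 * eta x ^ 2 - 1 / 10000) * w x ^ 2) =
      fun x => (deriv w x ^ 2 + (1 / 4 - 6 * eta x ^ 2) * w x ^ 2) - 1 / 10000 * w x ^ 2 := by
    ext x; ring
  have h := integral_nonneg_of_riccati (W := fun x => 1 / 4 - 6 * eta x ^ 2 - 1 / 10000)
    hw hw2 hdw2 (fun x => (hM x).1) (fun x => (hM x).2)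
    (fun x => (em (|x| = 34 / 25)).imp (h0 x) hasDerivAt_riccati)
    (fun x => .inr (riccatiDeriv_add_sq_le x))
    (by rw [heq]; exact hQ.sub (hw2.const_mul _))
  rw [heq, integral_sub hQ (hw2.const_mul _), integral_const_mul] at h
  linarith

lemma exists_form_coercive_L2 : ∃ κ : ℝ, 0 < κ ∧ ∀ u : ℝ → ℝ, (∀ x, u (-x) = u x) →
    Differentiable ℝ u → Integrable (fun x => u x ^ 2) → Integrable (fun x => deriv u x ^ 2) →
    ∫ x, u x * eta x = 0 →
    κ * ∫ x, u x ^ 2 ≤ ∫ x, (deriv u x ^ 2 + (1 / 4 - 6 * eta x ^ 2) * u x ^ 2) := by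
  set N := ∫ x, eta x ^ 2 with hN
  set K := ∫ x, etaScaling x ^ 2 with hK
  have hN0 : 0 < N := integral_eta_sq_pos
  have hK0 : 0 ≤ K := integral_nonneg fun x => sq_nonneg _
  refine ⟨min (1 / 20000) (N / (8 * (K + 1))), by positivity, ?_⟩
  intro u heven hu hu2 hdu2 horth
  have hum : MemLp u 2 :=
    (memLp_two_iff_integrable_sq hu.continuous.aestronglyMeasurable).2 hu2
  have hdum : MemLp (deriv u) 2 :=
    (memLp_two_iff_integrable_sq (measurable_deriv u).aestronglyMeasurable).2 hdu2
  obtain ⟨a, ha⟩ : ∃ a, u (34 / 25) = a * etaScaling (34 / 25) :=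
    ⟨_, (div_mul_cancel₀ _ etaScaling_pos.ne').symm⟩
  set w : ℝ → ℝ := fun x => u x - a * etaScaling x with hw
  have hwd : ∀ x, HasDerivAt w (deriv u x - a * etaScalingDeriv x) x := fun x =>
    (hu x).hasDerivAt.sub ((hasDerivAt_etaScaling x).const_mul a)
  have hdw : deriv w = fun x => deriv u x - a * etaScalingDeriv x :=
    funext fun x => (hwd x).deriv
  have hw2 : Integrable fun x => w x ^ 2 := (hum.sub (memLp_etaScaling.const_mul a)).integrable_sq
  have hdw2 : Integrable fun x => deriv w x ^ 2 := by
    rw [hdw]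
    exact (hdum.sub (memLp_etaScalingDeriv.const_mul a)).integrable_sq
  have h0 : ∀ x, |x| = 34 / 25 → w x = 0 := fun x hx => by
    rcases eq_or_eq_neg_of_abs_eq hx with rfl | rfl
    · simp only [hw, ha, sub_self]
    · simp only [hw, heven, etaScaling_neg, ha, sub_self]
  have h1 := integral_form_lower_bound_of_eq_zero (fun x => (hwd x).differentiableAt) hw2 hdw2 h0
  have h2 := integral_form_sub_etaScaling hu hu2 hdu2 horth a
  simp only [hdw] at h1
  rw [h2, ← hN] at h1
  have h3 : ∫ x, u x ^ 2 ≤ 2 * (∫ x, w x ^ 2) + 2 * a ^ 2 * K := by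
    have hf2 := memLp_etaScaling.integrable_sq
    rw [hK, ← integral_const_mul, ← integral_const_mul,
      ← integral_add (hw2.const_mul _) (hf2.const_mul _)]
    refine integral_mono hu2 ((hw2.const_mul _).add (hf2.const_mul _)) fun x => ?_
    simp only [hw]
    nlinarith [sq_nonneg (u x - 2 * (a * etaScaling x))]
  have hw0 : 0 ≤ ∫ x, w x ^ 2 := integral_nonneg fun x => sq_nonneg _
  have hκ1 := min_le_left (1 / 20000) (N / (8 * (K + 1)))
  have hκ2 := min_le_right (1 / 20000) (N / (8 * (K + 1)))
  have hκ0 : 0 ≤ min (1 / 20000) (N / (8 * (K + 1))) := by positivity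
  generalize min (1 / 20000) (N / (8 * (K + 1))) = κ at hκ0 hκ1 hκ2 ⊢
  rw [le_div_iff₀ (by positivity)] at hκ2
  have h4 := mul_le_mul_of_nonneg_left h3 hκ0
  have h5 := mul_le_mul_of_nonneg_right hκ1 hw0
  have h6 := mul_le_mul_of_nonneg_right hκ2 (sq_nonneg a)
  have h7 := mul_nonneg hκ0 (sq_nonneg a)
  nlinarith

lemma exists_form_coercive_H1 : ∃ c : ℝ, 0 < c ∧ ∀ u : ℝ → ℝ, (∀ x, u (-x) = u x) →
    Differentiable ℝ u → Integrable (fun x => u x ^ 2) → Integrable (fun x => deriv u x ^ 2) →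
    ∫ x, u x * eta x = 0 →
    c * H1sq u ≤ ∫ x, (deriv u x ^ 2 + (1 / 4 - 6 * eta x ^ 2) * u x ^ 2) := by
  obtain ⟨κ, hκ, h⟩ := exists_form_coercive_L2
  refine ⟨κ / (κ + 9 / 4), by positivity, fun u heven hu hu2 hdu2 horth => ?_⟩
  have h1 := h u heven hu hu2 hdu2 horth
  have h2 : (∫ x, deriv u x ^ 2) - 5 / 4 * ∫ x, u x ^ 2 ≤
      ∫ x, (deriv u x ^ 2 + (1 / 4 - 6 * eta x ^ 2) * u x ^ 2) := by
    rw [← integral_const_mul, ← integral_sub hdu2 (hu2.const_mul _)]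
    refine integral_mono (hdu2.sub (hu2.const_mul _))
      (hdu2.add (integrable_potential_mul hu2)) fun x => ?_
    have hη : eta x ^ 2 ≤ 1 / 4 := by nlinarith [eta_pos x, eta_le_half x]
    simp only
    nlinarith [mul_le_mul_of_nonneg_right hη (sq_nonneg (u x))]
  rw [H1sq, integral_add hu2 hdu2, div_mul_eq_mul_div, div_le_iff₀ (by positivity)]
  nlinarith

/-! ### The linearized operator -/

lemma integral_mul_deriv_deriv {u : ℝ → ℝ} (hu : Differentiable ℝ u)
    (hdu : Differentiable ℝ (deriv u)) (hum : MemLp u 2) (hdum : MemLp (deriv u) 2)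
    (hddum : MemLp (deriv (deriv u)) 2) :
    ∫ x, u x * deriv (deriv u) x = -∫ x, deriv u x ^ 2 := by
  have h1 : Integrable fun x => u x * deriv (deriv u) x := hum.integrable_mul hddum
  have h := integral_eq_zero_of_hasDerivAt_of_integrable
    (f := fun x => u x * deriv u x) (f' := fun x => deriv u x ^ 2 + u x * deriv (deriv u) x)
    (fun x => ((hu x).hasDerivAt.mul (hdu x).hasDerivAt).congr_deriv (by ring))
    (hdum.integrable_sq.add h1) (hum.integrable_mul hdum)
  rw [integral_add hdum.integrable_sq h1] at h
  linarith

/-- estimate (2.13): there is `c > 0` such that for every even `H²` function `u`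
orthogonal to `η`, `‖Au‖_{L²} ≥ c‖u‖_{H¹}` and `‖Au‖_{L²}² ≥ c⟨u, Au⟩`. -/
theorem linearized_operator_lower_bounds :
    ∃ c : ℝ, 0 < c ∧
      ∀ u : ℝ → ℝ, (∀ x, u (-x) = u x) →
        Differentiable ℝ u → Differentiable ℝ (deriv u) →
        Integrable (fun x => (u x)^2) → Integrable (fun x => (deriv u x)^2) →
        Integrable (fun x => (deriv (deriv u) x)^2) →
        (∫ x : ℝ, u x * eta x) = 0 →
        c * Real.sqrt (H1sq u) ≤ Real.sqrt (∫ x : ℝ, (Aop u x)^2) ∧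
        c * (∫ x : ℝ, u x * Aop u x) ≤ (∫ x : ℝ, (Aop u x)^2) := by
  obtain ⟨c, hc, hcoer⟩ := exists_form_coercive_H1
  refine ⟨c / 2, by positivity, fun u heven hu hdu hu2 hdu2 hddu2 horth => ?_⟩
  have hum : MemLp u 2 :=
    (memLp_two_iff_integrable_sq hu.continuous.aestronglyMeasurable).2 hu2
  have hdum : MemLp (deriv u) 2 :=
    (memLp_two_iff_integrable_sq hdu.continuous.aestronglyMeasurable).2 hdu2
  have hddum : MemLp (deriv (deriv u)) 2 :=
    (memLp_two_iff_integrable_sq (measurable_deriv _).aestronglyMeasurable).2 hddu2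
  obtain ⟨m, hm⟩ : ∃ m, ∀ x, Aop u x =
      (1/8) * u x - (1/2) * deriv (deriv u) x - 3 * (eta x)^2 * u x - m * eta x :=
    ⟨_, fun x => rfl⟩
  have hη2u : MemLp (fun x => 3 * eta x ^ 2 * u x) 2 := by
    have hcont := continuous_eta
    have hucont := hu.continuous
    refine hum.mono
      (by fun_prop : Continuous fun x => 3 * eta x ^ 2 * u x).aestronglyMeasurable
      (.of_forall fun x => ?_)
    rw [norm_mul, Real.norm_of_nonneg (by positivity)]
    refine mul_le_of_le_one_left (norm_nonneg _) ?_
    nlinarith [eta_pos x, eta_le_half x]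
  have hAm : MemLp (Aop u) 2 := by
    rw [funext hm]
    exact (((hum.const_mul _).sub (hddum.const_mul _)).sub hη2u).sub (memLp_eta.const_mul m)
  have hA2 : Integrable fun x => Aop u x ^ 2 := hAm.integrable_sq
  have huA : Integrable fun x => u x * Aop u x := hum.integrable_mul hAm
  have hform : ∫ x, u x * Aop u x =
      1 / 2 * ∫ x, (deriv u x ^ 2 + (1 / 4 - 6 * eta x ^ 2) * u x ^ 2) := by
    have heq : (fun x => u x * Aop u x) = fun x =>
        1 / 2 * ((1 / 4 - 6 * eta x ^ 2) * u x ^ 2) - 1 / 2 * (u x * deriv (deriv u) x) -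
          m * (u x * eta x) := by
      ext x; rw [hm]; ring
    have hV := integrable_potential_mul hu2
    have huddu : Integrable fun x => u x * deriv (deriv u) x := hum.integrable_mul hddum
    have huη : Integrable fun x => u x * eta x := hum.integrable_mul memLp_eta
    rw [heq, integral_sub (by exact (hV.const_mul _).sub (huddu.const_mul _)) (huη.const_mul _),
      integral_sub (hV.const_mul _) (huddu.const_mul _), integral_add hdu2 hV,
      integral_const_mul, integral_const_mul, integral_const_mul, horth,
      integral_mul_deriv_deriv hu hdu hum hdum hddum]
    ring
  have hY := hcoer u heven hu hu2 hdu2 horth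
  have hH : ∫ x, u x ^ 2 ≤ H1sq u :=
    integral_mono hu2 (hu2.add hdu2) fun x => le_add_of_nonneg_right (sq_nonneg _)
  have hH0 : 0 ≤ H1sq u := integral_nonneg fun x => by positivity
  have hyoung : c * ∫ x, u x * Aop u x ≤
      c ^ 2 / 4 * (∫ x, u x ^ 2) + ∫ x, Aop u x ^ 2 := by
    rw [← integral_const_mul, ← integral_const_mul, ← integral_add (hu2.const_mul _) hA2]
    refine integral_mono (huA.const_mul _) ((hu2.const_mul _).add hA2) fun x => ?_
    simp only
    nlinarith [sq_nonneg (c / 2 * u x - Aop u x)]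
  have hYA : c / 2 * ∫ x, u x * Aop u x ≤ ∫ x, Aop u x ^ 2 := by
    nlinarith [mul_le_mul_of_nonneg_left hH (sq_nonneg c), mul_le_mul_of_nonneg_left hY hc.le]
  refine ⟨?_, hYA⟩
  apply Real.le_sqrt_of_sq_le
  rw [mul_pow, Real.sq_sqrt hH0]
  nlinarith [mul_le_mul_of_nonneg_left hY hc.le]
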